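/- For each n ≥ 0, the set ℬⁿ of all strings of degree n in the symbols {a, b, c, e} in which 'ca' does not occur as a substring is a basis of the F₂-vector space V^{⊗n}. -/

import Mathlib

open TensorProduct PiTensorProduct

/-- The field `F₂`. -/
abbrev Ftwo := ZMod 2

/-- The 3-dimensional `F₂`-vector space `V` with basis `{a, b, c}`. -/
abbrev V : Type := Fin 3 → Ftwo

/-- The basis vector `a` of `V`. -/
noncomputable def va : V := Pi.basisFun Ftwo (Fin 3) 0
/-- The basis vector `b` of `V`. -/
noncomputable def vb : V := Pi.basisFun Ftwo (Fin 3) 1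
/-- The basis vector `c` of `V`. -/
noncomputable def vc : V := Pi.basisFun Ftwo (Fin 3) 2

/-- Graded multiplication (concatenation) of tensor powers of `V`. -/
noncomputable def tmulP {m n : ℕ} (x : ⨂[Ftwo]^m V) (y : ⨂[Ftwo]^n V) : ⨂[Ftwo]^(m+n) V :=
  @GradedMonoid.GMul.mul ℕ (fun i => ⨂[Ftwo]^i V) _ _ m n x y

/-- The four symbols `a`, `b`, `c`, `e`. -/
inductive Symb : Type
  | A : Symb
  | B : Symb
  | C : Symb
  | E : Symb
deriving DecidableEq

/-- The degree of a symbol: `|a| = |b| = |c| = 1` and `|e| = 2`. -/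
def Symb.deg : Symb → ℕ
  | .A => 1
  | .B => 1
  | .C => 1
  | .E => 2

/-- The degree of a string of symbols. -/
def degS (s : List Symb) : ℕ := (s.map Symb.deg).sum

/-- The element of `V^{⊗deg x}` corresponding to a symbol, where `e := a⊗c + c⊗a`. -/
noncomputable def symVal : (x : Symb) → ⨂[Ftwo]^(x.deg) V
  | .A => tprod Ftwo ![va]
  | .B => tprod Ftwo ![vb]
  | .C => tprod Ftwo ![vc]
  | .E => tprod Ftwo ![va, vc] + tprod Ftwo ![vc, va]

/-- Interpretation of a string of symbols as an element of `V^{⊗n}`, interpreting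
concatenation as the tensor product and substituting `e = a⊗c + c⊗a`. -/
noncomputable def interp : (s : List Symb) → ⨂[Ftwo]^(degS s) V
  | [] => @GradedMonoid.GOne.one ℕ (fun i => ⨂[Ftwo]^i V) _ _
  | x :: s => tmulP (symVal x) (interp s)

/-- Interpretation of a string of degree `n` as an element of `V^{⊗n}`. -/
noncomputable def interpN (n : ℕ) (s : List Symb) (h : degS s = n) : ⨂[Ftwo]^n V :=
  TensorPower.cast Ftwo V h (interp s)

/-- `ℬⁿ`: the set of strings of degree `n` in the symbols `{a,b,c,e}` in which `ca` does
not occur as a substring. -/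
def Bn (n : ℕ) : Set (List Symb) :=
  {s | degS s = n ∧ List.Chain' (fun x y => ¬(x = Symb.C ∧ y = Symb.A)) s}

/-- The family of elements of `V^{⊗n}` indexed by a set of strings of degree `n`. -/
noncomputable def interpFam (n : ℕ) (S : Set (List Symb)) (hS : ∀ s ∈ S, degS s = n)
    (s : S) : ⨂[Ftwo]^n V :=
  interpN n s (hS s s.2)

/-- `tmulP` as a bilinear map. -/
noncomputable def tmulPBilin (m n : ℕ) :
    (⨂[Ftwo]^m V) →ₗ[Ftwo] (⨂[Ftwo]^n V) →ₗ[Ftwo] (⨂[Ftwo]^(m + n) V) :=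
  (TensorProduct.mk Ftwo _ _).compr₂ (TensorPower.mulEquiv : _ ≃ₗ[Ftwo] (⨂[Ftwo]^(m + n)) V)

theorem tmulPBilin_apply {m n : ℕ} (x : ⨂[Ftwo]^m V) (y : ⨂[Ftwo]^n V) :
    tmulPBilin m n x y = tmulP x y :=
  rfl

theorem tmulP_tprod {m n : ℕ} (x : Fin m → V) (y : Fin n → V) :
    tmulP (tprod Ftwo x) (tprod Ftwo y) = tprod Ftwo (Fin.append x y) :=
  TensorPower.tprod_mul_tprod Ftwo x y

theorem tmulP_assoc {l m n : ℕ} (x : ⨂[Ftwo]^l V) (y : ⨂[Ftwo]^m V) (z : ⨂[Ftwo]^n V) :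
    TensorPower.cast Ftwo V (add_assoc l m n) (tmulP (tmulP x y) z) = tmulP x (tmulP y z) :=
  TensorPower.mul_assoc x y z

theorem add_tmulP {m n : ℕ} (x x' : ⨂[Ftwo]^m V) (y : ⨂[Ftwo]^n V) :
    tmulP (x + x') y = tmulP x y + tmulP x' y :=
  (tmulPBilin m n).map_add₂ x x' y

theorem tmulP_tprod_singleton {k : ℕ} (u v : V) (z : ⨂[Ftwo]^k V) :
    tmulP (tprod Ftwo ![u]) (tmulP (tprod Ftwo ![v]) z) =
      TensorPower.cast Ftwo V (add_assoc 1 1 k) (tmulP (tprod Ftwo ![u, v]) z) := by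
  have h : Fin.append ![u] ![v] = ![u, v] := by
    ext i : 1
    fin_cases i <;> rfl
  rw [← tmulP_assoc, tmulP_tprod, h]

theorem tmulP_c_a {k : ℕ} (z : ⨂[Ftwo]^k V) :
    tmulP (tprod Ftwo ![vc]) (tmulP (tprod Ftwo ![va]) z) =
      TensorPower.cast Ftwo V (add_assoc 1 1 k) (tmulP (symVal .E) z) +
        tmulP (tprod Ftwo ![va]) (tmulP (tprod Ftwo ![vc]) z) := by
  have h : tmulP (symVal .E) z =
      tmulP (tprod Ftwo ![va, vc]) z + tmulP (tprod Ftwo ![vc, va]) z :=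
    add_tmulP _ _ _
  rw [tmulP_tprod_singleton, tmulP_tprod_singleton]
  refine Eq.trans ?_ (congrArg (TensorPower.cast Ftwo V (add_assoc 1 1 k) · + _) h).symm
  refine Eq.trans ?_ (congrArg (· + _) (map_add _ _ _)).symm
  have hxy (x y : ⨂[Ftwo]^(1 + (1 + k)) V) : y = x + y + x := by
    rw [add_right_comm, ZModModule.add_self, zero_add]
  exact hxy _ _

/-- The span of the interpretations of the strings in `ℬⁿ`. -/
noncomputable def bSpan (n : ℕ) : Submodule Ftwo (⨂[Ftwo]^n V) :=
  Submodule.span Ftwo (Set.range (interpFam n (Bn n) (fun _ hs => hs.1)))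

theorem interpN_mem_bSpan {n : ℕ} {s : List Symb} (hs : s ∈ Bn n) :
    interpN n s hs.1 ∈ bSpan n :=
  Submodule.subset_span ⟨⟨s, hs⟩, rfl⟩

theorem cast_mem_bSpan {m n : ℕ} (h : m = n) {z : ⨂[Ftwo]^m V} (hz : z ∈ bSpan m) :
    TensorPower.cast Ftwo V h z ∈ bSpan n := by
  subst h
  simpa using hz

theorem tmulP_symVal_interpN (x : Symb) {m : ℕ} (s : List Symb) (h : degS s = m)
    (h' : degS (x :: s) = x.deg + m) :
    tmulP (symVal x) (interpN m s h) = interpN (x.deg + m) (x :: s) h' := by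
  subst h
  rw [interpN, TensorPower.cast_refl]
  exact (LinearEquiv.congr_fun (TensorPower.cast_refl Ftwo V h') _).symm

theorem interp_mem_bSpan {s : List Symb} (hs : s ∈ Bn (degS s)) : interp s ∈ bSpan (degS s) := by
  simpa [interpN] using interpN_mem_bSpan hs

theorem degS_cons (x : Symb) (s : List Symb) : degS (x :: s) = x.deg + degS s :=
  rfl

theorem cons_mem_Bn {x : Symb} {s : List Symb} {m : ℕ} (hs : s ∈ Bn m)
    (hx : x = .C → s.head? ≠ some .A) : x :: s ∈ Bn (x.deg + m) := by
  refine ⟨by rw [degS_cons, hs.1], List.isChain_cons.2 ⟨?_, hs.2⟩⟩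
  rintro y hy ⟨rfl, rfl⟩
  exact hx rfl hy

theorem tail_mem_Bn {x : Symb} {s : List Symb} {m : ℕ} (hs : x :: s ∈ Bn m) :
    s ∈ Bn (degS s) :=
  ⟨rfl, (List.isChain_cons.1 hs.2).2⟩

theorem head?_ne_A_of_C_cons {s : List Symb} {m : ℕ} (hs : .C :: s ∈ Bn m) :
    s.head? ≠ some .A :=
  fun h => (List.isChain_cons.1 hs.2).1 .A h ⟨rfl, rfl⟩

/-- To multiply `bSpan m` into a submodule on the left it suffices to check strings of `ℬᵐ`. -/
theorem tmulP_mem_of_forall_Bn {l m : ℕ} {x : ⨂[Ftwo]^l V} {W : Submodule Ftwo (⨂[Ftwo]^(l + m) V)}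
    (h : ∀ s (hs : s ∈ Bn m), tmulP x (interpN m s hs.1) ∈ W) {z : ⨂[Ftwo]^m V}
    (hz : z ∈ bSpan m) : tmulP x z ∈ W := by
  have : bSpan m ≤ W.comap (tmulPBilin l m x) := by
    refine Submodule.span_le.2 ?_
    rintro _ ⟨⟨s, hs⟩, rfl⟩
    exact h s hs
  exact this hz

theorem tmulP_symVal_mem_bSpan {x : Symb} (hx : x ≠ .C) {m : ℕ} {z : ⨂[Ftwo]^m V}
    (hz : z ∈ bSpan m) : tmulP (symVal x) z ∈ bSpan (x.deg + m) := by
  refine tmulP_mem_of_forall_Bn (fun s hs => ?_) hz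
  have h : x :: s ∈ Bn (x.deg + m) := cons_mem_Bn hs fun h => absurd h hx
  rw [tmulP_symVal_interpN x s hs.1 h.1]
  exact interpN_mem_bSpan h

theorem tmulP_C_mem_bSpan {m : ℕ} (hm : bSpan m = ⊤) {z : ⨂[Ftwo]^m V} (hz : z ∈ bSpan m) :
    tmulP (symVal .C) z ∈ bSpan (1 + m) := by
  refine tmulP_mem_of_forall_Bn (fun s hs => ?_) hz
  by_cases hA : s.head? = some .A
  · obtain ⟨t, rfl⟩ : ∃ t, s = .A :: t := by
      cases s with
      | nil => simp at hA
      | cons y t => exact ⟨t, by simpa using hA⟩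
    obtain rfl : 1 + degS t = m := hs.1
    have ht : interp t ∈ bSpan (degS t) := interp_mem_bSpan (tail_mem_Bn hs)
    have hst : interpN (1 + degS t) (.A :: t) hs.1 = tmulP (symVal .A) (interp t) := 
      LinearEquiv.congr_fun (TensorPower.cast_refl Ftwo V hs.1) _
    rw [hst]
    refine (congrArg (· ∈ bSpan (1 + (1 + degS t))) (tmulP_c_a (interp t))).mpr (add_mem ?_ ?_)
    · exact cast_mem_bSpan _ (tmulP_symVal_mem_bSpan (x := .E) (by decide) ht)
    · exact tmulP_symVal_mem_bSpan (x := .A) (by decide) (hm ▸ Submodule.mem_top)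
  · have h : .C :: s ∈ Bn (1 + m) := cons_mem_Bn (x := .C) hs fun _ => hA
    exact (tmulP_symVal_interpN .C s hs.1 h.1).symm ▸ interpN_mem_bSpan h

theorem tprod_singleton_eq (u : Fin 1 → V) :
    tprod Ftwo u = u 0 0 • tprod Ftwo ![va] + u 0 1 • tprod Ftwo ![vb] + u 0 2 • tprod Ftwo ![vc] := by
  let f : V →ₗ[Ftwo] ⨂[Ftwo]^1 V := (PiTensorProduct.tprod Ftwo).toLinearMap u 0
  have hf (v : V) : f v = tprod Ftwo ![v] := by
    simp only [f, MultilinearMap.toLinearMap_apply]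
    congr 1
    ext i : 1
    fin_cases i
    simp
  have hu : u = ![u 0] := by
    ext i : 1
    fin_cases i
    rfl
  have hsum : u 0 = u 0 0 • va + u 0 1 • vb + u 0 2 • vc := by
    ext i
    fin_cases i <;> simp [va, vb, vc]
  calc
    tprod Ftwo u = f (u 0) := by rw [hf, ← hu]
    _ = f (u 0 0 • va + u 0 1 • vb + u 0 2 • vc) := by rw [← hsum]
    _ = _ := by rw [map_add, map_add, map_smul, map_smul, map_smul, hf, hf, hf]

theorem bSpan_zero : bSpan 0 = ⊤ := by
  rw [eq_top_iff, ← span_tprod_eq_top, Submodule.span_le]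
  rintro _ ⟨v, rfl⟩
  rw [Subsingleton.elim v Fin.elim0]
  exact interp_mem_bSpan (s := []) ⟨rfl, List.isChain_nil⟩

theorem bSpan_one_add {m : ℕ} (hm : bSpan m = ⊤) : bSpan (1 + m) = ⊤ := by
  rw [eq_top_iff, ← span_tprod_eq_top, Submodule.span_le]
  rintro _ ⟨v, rfl⟩
  rw [← Fin.append_castAdd_natAdd (f := v), ← tmulP_tprod, tprod_singleton_eq]
  generalize tprod Ftwo (fun i => v (Fin.natAdd 1 i)) = z
  have hz : z ∈ bSpan m := hm ▸ Submodule.mem_top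
  rw [← tmulPBilin_apply]
  simp only [map_add, map_smul, LinearMap.add_apply, LinearMap.smul_apply]
  refine add_mem (add_mem ?_ ?_) ?_ <;> refine Submodule.smul_mem _ _ ?_
  · exact tmulP_symVal_mem_bSpan (x := .A) (by decide) hz
  · exact tmulP_symVal_mem_bSpan (x := .B) (by decide) hz
  · exact tmulP_C_mem_bSpan hm hz

theorem bSpan_eq_top (n : ℕ) : bSpan n = ⊤ := by
  induction n with
  | zero => exact bSpan_zero
  | succ m ih => exact Nat.add_comm 1 m ▸ bSpan_one_add ih

/-- The word in the letters `0, 1, 2` (for `a, b, c`) obtained by substituting `ca` for `e`. -/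
def expand : List Symb → List (Fin 3)
  | [] => []
  | .A :: s => 0 :: expand s
  | .B :: s => 1 :: expand s
  | .C :: s => 2 :: expand s
  | .E :: s => 2 :: 0 :: expand s

theorem length_expand (s : List Symb) : (expand s).length = degS s := by
  induction s with
  | nil => rfl
  | cons x s ih => cases x <;> simp [expand, ih, degS_cons, Symb.deg] <;> omega

theorem head?_eq_A_of_expand_eq {s : List Symb} {l : List (Fin 3)} (h : expand s = 0 :: l) :
    s.head? = some .A := by
  rcases s with _ | ⟨_ | _ | _ | _, s⟩ <;> simp_all [expand]

theorem expand_injective : ∀ {s t : List Symb}, s ∈ Bn (degS s) → t ∈ Bn (degS t) →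
    expand s = expand t → s = t
  | [], t, _, _, h => by rcases t with _ | ⟨_ | _ | _ | _, t⟩ <;> simp_all [expand]
  | x :: s, [], _, _, h => by cases x <;> simp [expand] at h
  | x :: s, y :: t, hs, ht, h => by
    have ih := expand_injective (tail_mem_Bn hs) (tail_mem_Bn ht)
    cases x <;> cases y <;> simp [expand] at h <;> try rw [ih h]
    · exact absurd (head?_eq_A_of_expand_eq h) (head?_ne_A_of_C_cons hs)
    · exact absurd (head?_eq_A_of_expand_eq h.symm) (head?_ne_A_of_C_cons ht)

/-- The word of length `n` obtained from a string in `ℬⁿ` by substituting `ca` for `e`. -/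
def expandVector (n : ℕ) (s : Bn n) : List.Vector (Fin 3) n :=
  ⟨expand s, (length_expand s).trans s.2.1⟩

theorem expandVector_injective (n : ℕ) : Function.Injective (expandVector n) := by
  rintro ⟨s, hs⟩ ⟨t, ht⟩ h
  exact Subtype.ext (expand_injective ⟨rfl, hs.2⟩ ⟨rfl, ht.2⟩ (congrArg Subtype.val h))

theorem finrank_tensorPower (n : ℕ) : Module.finrank Ftwo (⨂[Ftwo]^n V) = 3 ^ n := by
  rw [Module.finrank_eq_card_basis
    (Basis.piTensorProduct fun _ : Fin n => Pi.basisFun Ftwo (Fin 3))]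
  simp

/-- **Statement 3.** For each `n ≥ 0`, the set `ℬⁿ` of all strings of degree `n` in the symbols
`{a, b, c, e}` in which `ca` does not occur as a substring is a basis of the `F₂`-vector
space `V^{⊗n}`. -/
theorem stmt3 (n : ℕ) :
    LinearIndependent Ftwo (interpFam n (Bn n) (fun _ hs => hs.1)) ∧
    Submodule.span Ftwo (Set.range (interpFam n (Bn n) (fun _ hs => hs.1))) = ⊤ := by
  refine ⟨?_, bSpan_eq_top n⟩
  have : Finite (Bn n) := Finite.of_injective _ (expandVector_injective n)
  have := Fintype.ofFinite (Bn n)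
  refine linearIndependent_of_top_le_span_of_card_le_finrank (bSpan_eq_top n).ge ?_
  rw [finrank_tensorPower]
  simpa using Fintype.card_le_of_injective _ (expandVector_injective n)
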